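/- Let (V,q) be a quadratic space over ℚ₂ of even dimension d ≥ 4, let L be an odd unimodular lattice in (V,q), let Λ = {x ∈ L : q(x) ∈ 2ℤ₂}, and let Λ* = {x ∈ V : B_q(x,Λ) ⊆ ℤ₂} be the dual of Λ. Then the quotient group Λ*/Λ is isomorphic to ℤ/2ℤ × ℤ/2ℤ. -/

import Mathlib

/-- The symmetric bilinear form `B_q(x,y) = (q(x+y) - q(x) - q(y))/2` associated to a
quadratic form `q` on a `ℚ₂`-vector space `V`. -/
noncomputable def Bq {V : Type*} [AddCommGroup V] [Module ℚ_[2] V]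
    (q : QuadraticForm ℚ_[2] V) (x y : V) : ℚ_[2] :=
  (q (x + y) - q x - q y) / 2

/-- An element `c : ℚ₂` lies in `ℤ₂ ⊆ ℚ₂` iff its 2-adic norm is at most 1. -/
def IsIntegral2 (c : ℚ_[2]) : Prop := ‖c‖ ≤ 1

/-- A lattice in a `ℚ₂`-vector space `V`: a finitely generated `ℤ₂`-submodule
that spans `V` over `ℚ₂`. -/
def IsLattice {V : Type*} [AddCommGroup V] [Module ℚ_[2] V] [Module ℤ_[2] V]
    [IsScalarTower ℤ_[2] ℚ_[2] V] (L : Submodule ℤ_[2] V) : Prop :=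
  L.FG ∧ Submodule.span ℚ_[2] (L : Set V) = ⊤

/-- `x` lies in the dual lattice `L* = {x ∈ V : B_q(x, L) ⊆ ℤ₂}` of `L`. -/
def InDual {V : Type*} [AddCommGroup V] [Module ℚ_[2] V] [Module ℤ_[2] V]
    [IsScalarTower ℤ_[2] ℚ_[2] V] (q : QuadraticForm ℚ_[2] V) (L : Submodule ℤ_[2] V)
    (x : V) : Prop :=
  ∀ y ∈ L, IsIntegral2 (Bq q x y)

/-- `L` is unimodular: the dual lattice `L*` equals `L`. -/
def IsUnimodular {V : Type*} [AddCommGroup V] [Module ℚ_[2] V] [Module ℤ_[2] V]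
    [IsScalarTower ℤ_[2] ℚ_[2] V] (q : QuadraticForm ℚ_[2] V) (L : Submodule ℤ_[2] V) : Prop :=
  ∀ x : V, InDual q L x ↔ x ∈ L

/-- A lattice `L` is even when `q(L) ⊆ 2ℤ₂`; a unimodular lattice is odd when it is not even. -/
def IsEvenLat {V : Type*} [AddCommGroup V] [Module ℚ_[2] V] [Module ℤ_[2] V]
    [IsScalarTower ℤ_[2] ℚ_[2] V] (q : QuadraticForm ℚ_[2] V) (L : Submodule ℤ_[2] V) : Prop :=
  ∀ x ∈ L, IsIntegral2 (q x / 2)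

/-- The symmetric bilinear form `Bq q`, bundled. -/
noncomputable def bqForm {V : Type*} [AddCommGroup V] [Module ℚ_[2] V]
    (q : QuadraticForm ℚ_[2] V) : LinearMap.BilinForm ℚ_[2] V :=
  (2⁻¹ : ℚ_[2]) • q.polarBilin

lemma bqForm_apply {V : Type*} [AddCommGroup V] [Module ℚ_[2] V]
    (q : QuadraticForm ℚ_[2] V) (x y : V) : bqForm q x y = Bq q x y := by
  simp [bqForm, Bq, QuadraticMap.polar]
  ring

lemma Bq_self {V : Type*} [AddCommGroup V] [Module ℚ_[2] V]
    (q : QuadraticForm ℚ_[2] V) (x : V) : Bq q x x = q x := by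
  have h : q (x + x) = 4 * q x := by
    rw [← two_smul ℚ_[2] x, QuadraticMap.map_smul, smul_eq_mul]
    ring
  rw [Bq, h]
  ring

lemma Bq_comm {V : Type*} [AddCommGroup V] [Module ℚ_[2] V]
    (q : QuadraticForm ℚ_[2] V) (x y : V) : Bq q x y = Bq q y x := by
  rw [Bq, Bq, add_comm x y]
  ring

lemma Bq_add_left {V : Type*} [AddCommGroup V] [Module ℚ_[2] V]
    (q : QuadraticForm ℚ_[2] V) (x y z : V) : Bq q (x + y) z = Bq q x z + Bq q y z := by
  simp only [← bqForm_apply, map_add, LinearMap.add_apply]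

lemma Bq_add_right {V : Type*} [AddCommGroup V] [Module ℚ_[2] V]
    (q : QuadraticForm ℚ_[2] V) (x y z : V) : Bq q x (y + z) = Bq q x y + Bq q x z := by
  simp only [← bqForm_apply, map_add]

/-- A `2`-adic number satisfying `IsIntegral2`, as a `2`-adic integer. -/
def IsIntegral2.toInt {c : ℚ_[2]} (h : IsIntegral2 c) : ℤ_[2] := ⟨c, h⟩

lemma IsIntegral2.coe_toInt {c : ℚ_[2]} (h : IsIntegral2 c) : (h.toInt : ℚ_[2]) = c := rfl

lemma isIntegral2_iff {c : ℚ_[2]} : IsIntegral2 c ↔ ∃ a : ℤ_[2], (a : ℚ_[2]) = c :=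
  ⟨fun h => ⟨⟨c, h⟩, rfl⟩, by rintro ⟨a, rfl⟩; exact a.2⟩

lemma isIntegral2_coe (a : ℤ_[2]) : IsIntegral2 (a : ℚ_[2]) := a.2

lemma IsIntegral2.add {c e : ℚ_[2]} (hc : IsIntegral2 c) (he : IsIntegral2 e) :
    IsIntegral2 (c + e) := by
  obtain ⟨a, rfl⟩ := isIntegral2_iff.1 hc
  obtain ⟨b, rfl⟩ := isIntegral2_iff.1 he
  exact_mod_cast isIntegral2_coe (a + b)

lemma isIntegral2_half_iff (a : ℤ_[2]) :
    IsIntegral2 ((a : ℚ_[2]) / 2) ↔ PadicInt.toZMod a = 0 := by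
  rw [← RingHom.mem_ker, PadicInt.ker_toZMod, PadicInt.maximalIdeal_eq_span_p,
    Ideal.mem_span_singleton, isIntegral2_iff]
  have h2 : (((2 : ℕ) : ℤ_[2]) : ℚ_[2]) = 2 := PadicInt.coe_natCast 2
  constructor
  · rintro ⟨b, hb⟩
    refine ⟨b, ?_⟩
    apply PadicInt.ext
    rw [PadicInt.coe_mul, h2, hb]
    ring
  · rintro ⟨b, rfl⟩
    exact ⟨b, by rw [PadicInt.coe_mul, h2]; ring⟩

/-- The residue modulo two of an integral `2`-adic number. -/
noncomputable def IsIntegral2.residue {c : ℚ_[2]} (h : IsIntegral2 c) : ZMod 2 :=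
  PadicInt.toZMod h.toInt

lemma IsIntegral2.residue_eq {c : ℚ_[2]} (h : IsIntegral2 c) {a : ℤ_[2]} (ha : c = a) :
    h.residue = PadicInt.toZMod a := by
  subst ha
  rfl

lemma IsIntegral2.residue_eq_zero_iff {c : ℚ_[2]} (h : IsIntegral2 c) :
    h.residue = 0 ↔ IsIntegral2 (c / 2) :=
  (isIntegral2_half_iff h.toInt).symm

/-- Pairing with a vector `v`, reduced modulo two, on a lattice on which it is integral. -/
noncomputable def pairingMod {V : Type*} [AddCommGroup V] [Module ℚ_[2] V] [Module ℤ_[2] V]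
    (q : QuadraticForm ℚ_[2] V) (M : Submodule ℤ_[2] V) (v : V)
    (h : ∀ x ∈ M, IsIntegral2 (Bq q x v)) : M →+ ZMod 2 :=
  AddMonoidHom.mk' (fun x => (h x x.2).residue) fun x y => by
    refine ((h _ (x + y).2).residue_eq
      (a := (h x x.2).toInt + (h y y.2).toInt) ?_).trans (map_add _ _ _)
    rw [PadicInt.coe_add, IsIntegral2.coe_toInt, IsIntegral2.coe_toInt, Submodule.coe_add,
      Bq_add_left]

lemma pairingMod_apply {V : Type*} [AddCommGroup V] [Module ℚ_[2] V] [Module ℤ_[2] V]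
    (q : QuadraticForm ℚ_[2] V) (M : Submodule ℤ_[2] V) (v : V)
    (h : ∀ x ∈ M, IsIntegral2 (Bq q x v)) (x : M) :
    pairingMod q M v h x = (h x x.2).residue := rfl

lemma zmod_two_eq_one_of_ne_zero {a : ZMod 2} (h : a ≠ 0) : a = 1 := by
  revert a
  decide

/-- Off-diagonal entries of a symmetric matrix cancel in characteristic two. -/
lemma sum_sum_eq_sum_diag {R ι : Type*} [CommRing R] [CharP R 2] (A : ι → ι → R)
    (hA : ∀ i j, A i j = A j i) (s : Finset ι) :
    ∑ i ∈ s, ∑ j ∈ s, A i j = ∑ i ∈ s, A i i := by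
  classical
  induction s using Finset.induction_on with
  | empty => simp
  | insert a s ha ih =>
    simp only [Finset.sum_insert ha, Finset.sum_add_distrib, ih, hA a]
    linear_combination CharTwo.add_self_eq_zero (∑ i ∈ s, A i a)

section Reduction

variable {R M ι : Type*} [CommRing R] [AddCommGroup M] [Module R M]
  (b : LinearMap.BilinForm R M) (φ : R →+* ZMod 2)

lemma map_self_sum_smul (hb : ∀ x y, b x y = b y x) (s : Finset ι) (c : ι → R) (v : ι → M) :
    φ (b (∑ i ∈ s, c i • v i) (∑ i ∈ s, c i • v i)) = ∑ i ∈ s, φ (c i) * φ (b (v i) (v i)) := by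
  have h := sum_sum_eq_sum_diag (fun i j => φ (c i) * φ (c j) * φ (b (v i) (v j)))
    (fun i j => by rw [hb]; ring) s
  have hsq : ∀ a : ZMod 2, a * a = a := by decide
  simp only [hsq] at h
  rw [← h]
  simp only [map_sum, map_smul, LinearMap.sum_apply, LinearMap.smul_apply, smul_eq_mul, map_mul]
  refine Finset.sum_congr rfl fun i _ => ?_
  rw [Finset.mul_sum]
  refine Finset.sum_congr rfl fun j _ => ?_
  rw [hb]
  ring

/-- A symmetric bilinear form with a pair of dual bases has a characteristic vector modulo two,
whose square is congruent to the rank. -/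
lemma exists_characteristic_vector [Fintype ι] [DecidableEq ι] (hb : ∀ x y, b x y = b y x)
    (e : Module.Basis ι R M) (f : ι → M) (hf : ∀ i j, b (f i) (e j) = if j = i then 1 else 0) :
    ∃ w : M, (∀ x, φ (b w x) = φ (b x x)) ∧ φ (b w w) = Fintype.card ι := by
  have hrepr : ∀ i x, b (f i) x = e.repr x i := by
    intro i x
    conv_lhs => rw [← e.sum_repr x]
    simp [-Module.Basis.sum_repr, hf]
  refine ⟨∑ i, b (e i) (e i) • f i, fun x => ?_, ?_⟩
  · conv_rhs => rw [← e.sum_repr x]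
    rw [map_self_sum_smul b φ hb]
    simp [-Module.Basis.sum_repr, hrepr, mul_comm]
  · rw [map_self_sum_smul b φ hb]
    have htrace : ∀ i, ∑ j, b (f i) (f j) * b (e i) (e j) = 1 := by
      intro i
      have h : b (f i) (e i) = 1 := by simp [hf]
      conv_lhs at h => rw [← e.sum_repr (f i)]
      rw [← h]
      simp [-Module.Basis.sum_repr, ← hrepr, hb _ (f i), hb _ (e i)]
    have h := sum_sum_eq_sum_diag (fun i j => φ (b (f i) (f j)) * φ (b (e i) (e j)))
      (fun i j => by rw [hb (f i), hb (e i)]) Finset.univ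
    simp only [← map_mul, ← map_sum, htrace] at h
    simp only [← map_mul, ← map_sum]
    simp only [mul_comm (b (e _) (e _))]
    rw [← h]
    simp

end Reduction

section Lattice

variable {V : Type*} [AddCommGroup V] [Module ℚ_[2] V] [Module ℤ_[2] V]
  [IsScalarTower ℤ_[2] ℚ_[2] V]

lemma IsUnimodular.isIntegral2_Bq {q : QuadraticForm ℚ_[2] V} {L : Submodule ℤ_[2] V}
    (hL : IsUnimodular q L) {x y : V} (hx : x ∈ L) (hy : y ∈ L) : IsIntegral2 (Bq q x y) :=
  (hL x).2 hx y hy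

lemma Bq_smul_left (q : QuadraticForm ℚ_[2] V) (a : ℤ_[2]) (x y : V) :
    Bq q (a • x) y = a * Bq q x y := by
  rw [← algebraMap_smul ℚ_[2] a x]
  simp only [← bqForm_apply, map_smul, LinearMap.smul_apply, smul_eq_mul,
    PadicInt.algebraMap_apply]

/-- The restriction of `Bq q` to a unimodular lattice, as a `ℤ₂`-valued bilinear form. -/
noncomputable def IsUnimodular.form {q : QuadraticForm ℚ_[2] V} {L : Submodule ℤ_[2] V}
    (hL : IsUnimodular q L) : LinearMap.BilinForm ℤ_[2] L :=
  LinearMap.mk₂ ℤ_[2] (fun x y => (hL.isIntegral2_Bq x.2 y.2).toInt)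
    (fun x y z => PadicInt.ext (Bq_add_left q x y z))
    (fun a x y => PadicInt.ext (Bq_smul_left q a x y))
    (fun x y z => PadicInt.ext (Bq_add_right q x y z))
    (fun a x y => PadicInt.ext <| by
      rw [smul_eq_mul, PadicInt.coe_mul]
      simp only [IsIntegral2.coe_toInt, Submodule.coe_smul, Bq_comm q x, Bq_smul_left])

lemma IsUnimodular.coe_form {q : QuadraticForm ℚ_[2] V} {L : Submodule ℤ_[2] V}
    (hL : IsUnimodular q L) (x y : L) : (hL.form x y : ℚ_[2]) = Bq q x y := rfl

lemma IsUnimodular.exists_characteristic_vector [FiniteDimensional ℚ_[2] V]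
    {q : QuadraticForm ℚ_[2] V} (hnd : ∀ x : V, (∀ y : V, Bq q x y = 0) → x = 0)
    {L : Submodule ℤ_[2] V} (hL : IsLattice L) (hLuni : IsUnimodular q L) :
    ∃ w : L, (∀ x, PadicInt.toZMod (hLuni.form w x) = PadicInt.toZMod (hLuni.form x x)) ∧
      PadicInt.toZMod (hLuni.form w w) = Module.finrank ℚ_[2] V := by
  have : Submodule.IsLattice ℚ_[2] L := ⟨hL.1, hL.2⟩
  have : Module.IsTorsionFree ℤ_[2] V := .trans_faithfulSMul ℤ_[2] ℚ_[2] V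
  classical
  let e := Module.Free.chooseBasis ℤ_[2] L
  let E := e.extendOfIsLattice ℚ_[2]
  have hE : ∀ i, E i = e i := fun i => e.extendOfIsLattice_apply ℚ_[2] i
  have hB : (bqForm q).Nondegenerate := by
    refine ⟨fun x hx => hnd x fun y => ?_, fun x hx => hnd x fun y => ?_⟩
    · rw [← bqForm_apply, hx]
    · rw [Bq_comm, ← bqForm_apply, hx]
  let F := (bqForm q).dualBasis hB E
  have hF : ∀ i j, bqForm q (F i) (E j) = if j = i then 1 else 0 :=
    (bqForm q).apply_dualBasis_left hB E
  have hFL : ∀ i, F i ∈ L := by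
    intro i
    refine (hLuni _).1 fun y hy => ?_
    have hy' : y = ∑ j, (e.repr ⟨y, hy⟩ j : ℚ_[2]) • E j := by
      conv_lhs => rw [show y = ((⟨y, hy⟩ : L) : V) from rfl, ← e.sum_repr ⟨y, hy⟩]
      simp [-Module.Basis.sum_repr, hE, ← PadicInt.algebraMap_apply]
    rw [← bqForm_apply, hy', map_sum]
    simp only [map_smul, hF]
    simpa using isIntegral2_coe _
  rw [Module.finrank_eq_card_basis E]
  refine _root_.exists_characteristic_vector hLuni.form PadicInt.toZMod
    (fun x y => PadicInt.ext (Bq_comm q x y)) e (fun i => ⟨F i, hFL i⟩) fun i j => ?_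
  apply PadicInt.ext
  change Bq q (F i) (e j) = _
  rw [← bqForm_apply, ← hE, hF]
  split_ifs <;> simp

end Lattice

/-- Let `(V, q)` over `ℚ₂` have even dimension `d ≥ 4`, `L` an odd unimodular lattice,
`Λ = {x ∈ L : q(x) ∈ 2ℤ₂}` and `Λ*` the dual of `Λ`. Then `Λ*/Λ ≅ ℤ/2ℤ × ℤ/2ℤ`. -/
theorem dual_quotient_even_dim
    {V : Type*} [AddCommGroup V] [Module ℚ_[2] V] [Module ℤ_[2] V]
    [IsScalarTower ℤ_[2] ℚ_[2] V] [FiniteDimensional ℚ_[2] V]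
    (d : ℕ) (hd4 : 4 ≤ d) (hdeven : Even d) (hdim : Module.finrank ℚ_[2] V = d)
    (q : QuadraticForm ℚ_[2] V)
    (hnd : ∀ x : V, (∀ y : V, Bq q x y = 0) → x = 0)
    (L : Submodule ℤ_[2] V) (hL : IsLattice L)
    (hLuni : IsUnimodular q L) (hLodd : ¬ IsEvenLat q L)
    (Λ : Submodule ℤ_[2] V)
    (hΛ : (Λ : Set V) = {x : V | x ∈ L ∧ IsIntegral2 (q x / 2)})
    (Λd : Submodule ℤ_[2] V)
    (hΛd : (Λd : Set V) = {x : V | ∀ y ∈ Λ, IsIntegral2 (Bq q x y)}) :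
    Nonempty ((↥Λd ⧸ Submodule.comap Λd.subtype Λ) ≃+ (ZMod 2 × ZMod 2)) := by
  obtain ⟨w, hw, hww⟩ := hLuni.exists_characteristic_vector hnd hL
  have hself : ∀ x : L, (hLuni.form x x : ℚ_[2]) = q x := fun x => by
    rw [hLuni.coe_form, Bq_self]
  have hΛ' : ∀ x : V, x ∈ Λ ↔ ∃ hx : x ∈ L, PadicInt.toZMod (hLuni.form ⟨x, hx⟩ ⟨x, hx⟩) = 0 := by
    intro x
    rw [← SetLike.mem_coe, hΛ]
    simp only [← isIntegral2_half_iff, hself, Set.mem_ofPred_eq, exists_prop]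
  have hΛd' : ∀ x : V, x ∈ Λd ↔ ∀ y ∈ Λ, IsIntegral2 (Bq q x y) := by
    intro x
    rw [← SetLike.mem_coe, hΛd, Set.mem_ofPred_eq]
  obtain ⟨u, hu⟩ : ∃ u : L, PadicInt.toZMod (hLuni.form u u) = 1 := by
    by_contra! h
    refine hLodd fun x hx => ?_
    rw [← hself ⟨x, hx⟩, isIntegral2_half_iff]
    by_contra h0
    exact h _ (zmod_two_eq_one_of_ne_zero h0)
  have hwΛ : (w : V) ∈ Λ := by
    refine (hΛ' _).2 ⟨w.2, ?_⟩
    rw [Subtype.coe_eta, hww, hdim]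
    exact hdeven.natCast_zmod_two
  have huΛ : ((u + u : L) : V) ∈ Λ := by
    refine (hΛ' _).2 ⟨(u + u).2, ?_⟩
    rw [Subtype.coe_eta, ← hw, map_add, map_add, CharTwo.add_self_eq_zero]
  have hLΛd : ∀ x ∈ L, x ∈ Λd := fun x hx => (hΛd' x).2 fun y hy =>
    hLuni.isIntegral2_Bq hx ((hΛ' y).1 hy).1
  have huuΛd : ∀ x ∈ Λd, IsIntegral2 (Bq q x (u + u : L)) := fun x hx => (hΛd' x).1 hx _ huΛ
  have hwΛd : ∀ x ∈ Λd, IsIntegral2 (Bq q x w) := fun x hx => (hΛd' x).1 hx _ hwΛ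
  have hψL : ∀ x : L, pairingMod q Λd w hwΛd ⟨x, hLΛd x x.2⟩ =
      PadicInt.toZMod (hLuni.form x x) := by
    intro x
    rw [← hw, pairingMod_apply]
    exact IsIntegral2.residue_eq _ (Bq_comm q x w)
  have huu : ∀ x, Bq q x ((u + u : L) : V) / 2 = Bq q x u := fun x => by
    rw [Submodule.coe_add, Bq_add_right]
    ring
  have hψu : ∀ x : L, pairingMod q Λd _ huuΛd ⟨x, hLΛd x x.2⟩ = 0 := fun x => by
    rw [pairingMod_apply, IsIntegral2.residue_eq_zero_iff, huu]
    exact hLuni.isIntegral2_Bq x.2 u.2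
  have hker : ∀ x : Λd, pairingMod q Λd _ huuΛd x = 0 → (x : V) ∈ L := by
    intro x hx
    rw [pairingMod_apply, IsIntegral2.residue_eq_zero_iff, huu] at hx
    refine (hLuni _).1 fun y hy => ?_
    by_cases hyΛ : y ∈ Λ
    · exact (hΛd' x).1 x.2 y hyΛ
    · have hyu : y - u ∈ Λ := by
        have hy1 : PadicInt.toZMod (hLuni.form ⟨y, hy⟩ ⟨y, hy⟩) = 1 :=
          zmod_two_eq_one_of_ne_zero fun h => hyΛ ((hΛ' y).2 ⟨hy, h⟩)
        refine (hΛ' _).2 ⟨L.sub_mem hy u.2, ?_⟩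
        rw [← hw, show (⟨y - u, L.sub_mem hy u.2⟩ : L) = ⟨y, hy⟩ - u from rfl, map_sub, map_sub,
          hw, hw, hu, hy1, sub_self]
      have := ((hΛd' x).1 x.2 _ hyu).add hx
      rwa [← Bq_add_right, sub_add_cancel] at this
  have hhalf : ∀ y, Bq q ((2⁻¹ : ℚ_[2]) • (w : V)) y = Bq q w y / 2 := fun y => by
    rw [← bqForm_apply, ← bqForm_apply, map_smul, LinearMap.smul_apply, smul_eq_mul]
    ring
  have hwd : (2⁻¹ : ℚ_[2]) • (w : V) ∈ Λd := by
    refine (hΛd' _).2 fun y hy => ?_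
    obtain ⟨hyL, hy0⟩ := (hΛ' y).1 hy
    rw [hhalf]
    exact (isIntegral2_half_iff (hLuni.form w ⟨y, hyL⟩)).2 ((hw _).trans hy0)
  have hψw : pairingMod q Λd _ huuΛd ⟨_, hwd⟩ = 1 := by
    refine zmod_two_eq_one_of_ne_zero fun h => ?_
    rw [pairingMod_apply, IsIntegral2.residue_eq_zero_iff, huu, hhalf] at h
    have := (isIntegral2_half_iff (hLuni.form w u)).1 h
    rw [hw, hu] at this
    exact one_ne_zero this
  let Ψ : Λd →+ ZMod 2 × ZMod 2 := (pairingMod q Λd _ huuΛd).prod (pairingMod q Λd w hwΛd)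
  have hΨker : Ψ.ker = (Submodule.comap Λd.subtype Λ).toAddSubgroup := by
    ext x
    rw [AddMonoidHom.mem_ker, Submodule.mem_toAddSubgroup, Submodule.mem_comap,
      Submodule.subtype_apply, hΛ', AddMonoidHom.prod_apply, Prod.mk_eq_zero]
    constructor
    · rintro ⟨h1, h2⟩
      exact ⟨hker x h1, (hψL ⟨x, hker x h1⟩).symm.trans h2⟩
    · rintro ⟨hx, h⟩
      exact ⟨hψu ⟨x, hx⟩, (hψL ⟨x, hx⟩).trans h⟩
  have hΨsurj : Function.Surjective Ψ := by
    let a : Λd := ⟨_, hwd⟩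
    let b : Λd := ⟨u, hLΛd u u.2⟩
    have ha : Ψ a = (1, pairingMod q Λd w hwΛd a) := Prod.ext hψw rfl
    have hb : Ψ b = (0, 1) := Prod.ext (hψu u) ((hψL u).trans hu)
    have key : ∀ t s : ZMod 2 × ZMod 2, t.1 = 1 → s = (0, 1) →
        ∀ z, z = 0 ∨ z = t ∨ z = s ∨ z = t + s := by decide
    intro z
    rcases key (Ψ a) (Ψ b) (by rw [ha]) hb z with h | h | h | h
    · exact ⟨0, by rw [h, map_zero]⟩
    · exact ⟨a, h.symm⟩
    · exact ⟨b, h.symm⟩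
    · exact ⟨a + b, by rw [h, map_add]⟩
  exact ⟨(QuotientAddGroup.quotientAddEquivOfEq hΨker.symm).trans
    (QuotientAddGroup.quotientKerEquivOfSurjective Ψ hΨsurj)⟩
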